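/- Let r ≤ n, let V_A, V_B be n×r complex matrices that are isometries (V_A^* V_A = I_r and V_B^* V_B = I_r), let Δ be an r×r diagonal matrix with strictly positive diagonal entries, and set A = V_A Δ V_A^*, B = V_B V_B^*, Σ = Δ^{-1/2}, P_A = V_A V_A^*. If an n×n complex matrix F satisfies F A F^* = B and F P_A = F, then there exists an r×r unitary matrix W such that F = V_B W Σ V_A^*. -/

import Mathlib

open Matrix

/-- If `G * Gᴴ = V * Vᴴ` for an isometry `V` of the same size as `G`, then `G = V * W` for a
unitary `W`. -/
theorem exists_unitary_of_mul_conjTranspose_eq {m k R : Type*} [Fintype m] [Fintype k]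
    [DecidableEq k] [CommRing R] [StarRing R] {G V : Matrix m k R}
    (hV : Vᴴ * V = 1) (hG : G * Gᴴ = V * Vᴴ) :
    ∃ W : Matrix k k R, Wᴴ * W = 1 ∧ W * Wᴴ = 1 ∧ G = V * W := by
  have hGW : G * (Vᴴ * G)ᴴ = V := by
    rw [conjTranspose_mul, conjTranspose_conjTranspose, ← Matrix.mul_assoc, hG,
      Matrix.mul_assoc, hV, Matrix.mul_one]
  have hW : Vᴴ * G * (Vᴴ * G)ᴴ = 1 := by
    rw [Matrix.mul_assoc, hGW, hV]
  have hW' : (Vᴴ * G)ᴴ * (Vᴴ * G) = 1 := mul_eq_one_comm.mp hW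
  refine ⟨Vᴴ * G, hW', hW, ?_⟩
  nth_rewrite 1 [← Matrix.mul_one G, ← hW']
  rw [← Matrix.mul_assoc, hGW]

/-- Let `r ≤ n`, let `V_A, V_B` be `n×r` isometries, let `Δ` be an `r×r` diagonal matrix
with strictly positive diagonal entries `d`, and set `A = V_A Δ V_A^*`, `B = V_B V_B^*`,
`Σ = Δ^{-1/2}`, `P_A = V_A V_A^*`.  If an `n×n` matrix `F` satisfies `F A F^* = B` and
`F P_A = F`, then `F = V_B W Σ V_A^*` for some `r×r` unitary `W`. -/
theorem solution_is_FW {n r : ℕ} (hrn : r ≤ n)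
    (VA VB : Matrix (Fin n) (Fin r) ℂ)
    (hVA : VAᴴ * VA = 1) (hVB : VBᴴ * VB = 1)
    (d : Fin r → ℝ) (hd : ∀ i, 0 < d i)
    (F : Matrix (Fin n) (Fin n) ℂ)
    (hF : F * (VA * Matrix.diagonal (fun i => ((d i : ℝ) : ℂ)) * VAᴴ) * Fᴴ = VB * VBᴴ)
    (hFP : F * (VA * VAᴴ) = F) :
    ∃ W : Matrix (Fin r) (Fin r) ℂ, Wᴴ * W = 1 ∧ W * Wᴴ = 1 ∧
      F = VB * W * Matrix.diagonal (fun i => ((Real.sqrt (d i))⁻¹ : ℂ)) * VAᴴ := by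
  set S : Matrix (Fin r) (Fin r) ℂ := diagonal fun i => ((Real.sqrt (d i) : ℝ) : ℂ) with hS
  have hSH : Sᴴ = S := by
    rw [hS, diagonal_conjTranspose]
    congr 1
    ext i
    simp
  have hSS : S * S = diagonal fun i => ((d i : ℝ) : ℂ) := by
    rw [hS, diagonal_mul_diagonal]
    congr 1
    ext i
    rw [← Complex.ofReal_mul, Real.mul_self_sqrt (hd i).le]
  have hSinv : S * diagonal (fun i => ((Real.sqrt (d i))⁻¹ : ℂ)) = 1 := by
    rw [hS, diagonal_mul_diagonal, ← diagonal_one]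
    congr 1
    ext i
    exact mul_inv_cancel₀ (Complex.ofReal_ne_zero.mpr (Real.sqrt_pos.mpr (hd i)).ne')
  have hG : F * VA * S * (F * VA * S)ᴴ = VB * VBᴴ := by
    rw [← hF, ← hSS]
    simp only [conjTranspose_mul, hSH, Matrix.mul_assoc]
  obtain ⟨W, hW, hW', hGW⟩ := exists_unitary_of_mul_conjTranspose_eq hVB hG
  refine ⟨W, hW, hW', ?_⟩
  rw [← hGW, Matrix.mul_assoc (F * VA), hSinv, Matrix.mul_one, Matrix.mul_assoc, hFP]
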